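/- arXiv:1904.03572 — 3 statements merged into one kernel-verified Lean document; each statement's English description precedes it below -/
import Mathlib

section
/- (Uniqueness theorem for C^n-holomorphic functions.) Let U be a connected open subset of C^{l1}×...×C^{ln}, let f, g ∈ O_{l1,...,ln}(U), and let a ∈ U. If for every multi-index α the derivatives ∂^{|α|}f/∂z^α(a) = ∂^{|α|}g/∂z^α(a) agree, then f = g on U. -/
open Set Metric

/-- `f : ℂ^{l 0} × ... × ℂ^{l (n-1)} → ℂ^n` is `ℂⁿ`-holomorphic on `U`:
holomorphic, and for `i ≠ j` the partial derivative of the `i`-th component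
in every direction of the `j`-th coordinate block vanishes. -/
def CnHolo {n : ℕ} {l : Fin n → ℕ} (U : Set (∀ j, Fin (l j) → ℂ))
    (f : (∀ j, Fin (l j) → ℂ) → (Fin n → ℂ)) : Prop :=
  DifferentiableOn ℂ f U ∧
    ∀ a ∈ U, ∀ i j : Fin n, i ≠ j → ∀ v : Fin (l j) → ℂ,
      fderiv ℂ (fun z => f z i) a (Pi.single j v) = 0

section SeveralComplexVariables

variable {E F : Type*} [NormedAddCommGroup E] [NormedSpace ℂ E]
  [NormedAddCommGroup F] [NormedSpace ℂ F]

/-- A directional derivative of a holomorphic function of several variables is holomorphic. -/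
theorem differentiableOn_fderiv_apply [FiniteDimensional ℂ E] [FiniteDimensional ℂ F]
    {U : Set E} {f : E → F} (hf : DifferentiableOn ℂ f U) (hU : IsOpen U) (v : E) :
    DifferentiableOn ℂ (fun z => fderiv ℂ f z v) U := by
  intro z₀ hz₀
  have : CompleteSpace F := FiniteDimensional.complete ℂ F
  have : ProperSpace (E →L[ℂ] F) := FiniteDimensional.proper ℂ _
  let _ : MeasurableSpace E := borel E
  have : BorelSpace E := ⟨rfl⟩
  let _ : MeasurableSpace (E →L[ℂ] F) := borel _
  have : BorelSpace (E →L[ℂ] F) := ⟨rfl⟩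
  obtain ⟨δ, hδ, hball⟩ := Metric.mem_nhds_iff.1 (Filter.inter_mem (hU.mem_nhds hz₀)
    ((hf.continuousOn.continuousAt (hU.mem_nhds hz₀)).preimage_mem_nhds
      (ball_mem_nhds (f z₀) one_pos)))
  have hd : ∀ w ∈ ball z₀ δ, DifferentiableAt ℂ f w := fun w hw =>
    hf.differentiableAt (hU.mem_nhds (hball hw).1)
  have hbound : ∀ w ∈ ball z₀ (δ / 2), ‖fderiv ℂ f w‖ ≤ 2 / (δ / 2) := by
    intro w hw
    have hsub : ball w (δ / 2) ⊆ ball z₀ δ :=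
      ball_subset_ball' (by linarith [mem_ball.1 hw])
    refine Complex.norm_fderiv_le_div_of_mapsTo_ball
      (fun y hy => (hd y (hsub hy)).differentiableWithinAt) (fun y hy => ?_) (half_pos hδ)
    have h1 : dist (f y) (f z₀) < 1 := (hball (hsub hy)).2
    have h2 : dist (f w) (f z₀) < 1 := (hball (hsub (mem_ball_self (half_pos hδ)))).2
    rw [mem_closedBall]
    linarith [dist_triangle_right (f y) (f w) (f z₀)]
  set r : ℝ := δ / (4 * (‖v‖ + 1)) with hr_def
  have hr : 0 < r := by positivity
  have hrv : r * ‖v‖ < δ / 4 := by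
    have h : r * (‖v‖ + 1) = δ / 4 := by rw [hr_def]; field_simp
    linarith
  have hmem : ∀ x ∈ ball z₀ (δ / 4), ∀ ζ : ℂ, ‖ζ‖ ≤ r → x + ζ • v ∈ ball z₀ (δ / 2) := by
    intro x hx ζ hζ
    have h1 : ‖ζ • v‖ ≤ r * ‖v‖ := by
      rw [norm_smul]; gcongr
    have h2 : dist (x + ζ • v) x = ‖ζ • v‖ := by simp
    rw [mem_ball] at hx ⊢
    linarith [dist_triangle (x + ζ • v) x z₀]
  have hhalf : ball z₀ (δ / 2) ⊆ ball z₀ δ := ball_subset_ball (by linarith)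
  have hcircle : ∀ θ : ℝ, ‖circleMap 0 r θ‖ ≤ r := fun θ => by simp [abs_of_pos hr]
  have hcauchy : ∀ x ∈ ball z₀ (δ / 4), fderiv ℂ f x v =
      (2 * Real.pi * Complex.I : ℂ)⁻¹ • ∫ θ in (0 : ℝ)..2 * Real.pi,
        (deriv (circleMap 0 r) θ * (1 / (circleMap 0 r θ) ^ 2)) •
          f (x + circleMap 0 r θ • v) := by
    intro x hx
    have hline : ∀ ζ : ℂ, HasDerivAt (fun ζ : ℂ => x + ζ • v) v ζ := fun ζ => by
      simpa using ((hasDerivAt_id ζ).smul_const v).const_add x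
    have hdiff : DifferentiableOn ℂ (fun ζ : ℂ => f (x + ζ • v)) (closedBall 0 r) := by
      intro ζ hζ
      refine (DifferentiableAt.comp ζ (hd _ (hhalf (hmem x hx ζ (by simpa using hζ))))
        (hline ζ).differentiableAt).differentiableWithinAt
    have hderiv : deriv (fun ζ : ℂ => f (x + ζ • v)) 0 = fderiv ℂ f x v := by
      have h := hd _ (hhalf (hmem x hx 0 (by simpa using hr.le)))
      have := (h.hasFDerivAt.comp_hasDerivAt (0 : ℂ) (hline 0)).deriv
      simpa [Function.comp_def] using this
    have key := hdiff.deriv_eq_smul_circleIntegral hr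
    rw [hderiv] at key
    rw [eq_inv_smul_iff₀ Complex.two_pi_I_ne_zero, ← key, circleIntegral]
    simp only [sub_zero, smul_smul]
  have hcoef : Continuous fun θ : ℝ =>
      deriv (circleMap 0 r) θ * (1 / (circleMap 0 r θ) ^ 2) := by
    simp only [deriv_circleMap]
    refine ((continuous_circleMap 0 r).mul continuous_const).mul
      (continuous_const.div ((continuous_circleMap 0 r).pow 2) fun θ => ?_)
    exact pow_ne_zero 2 (circleMap_ne_center hr.ne')
  have hcont : ∀ x ∈ ball z₀ (δ / 4), Continuous fun θ : ℝ =>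
      (deriv (circleMap 0 r) θ * (1 / (circleMap 0 r θ) ^ 2)) •
        f (x + circleMap 0 r θ • v) := by
    intro x hx
    refine hcoef.smul (continuous_iff_continuousAt.2 fun θ => ?_)
    exact ContinuousAt.comp (f := fun θ : ℝ => x + circleMap 0 r θ • v)
      (hd _ (hhalf (hmem x hx _ (hcircle θ)))).continuousAt
      (by fun_prop)
  have hδ4 : ball z₀ (δ / 4) ∈ nhds z₀ := ball_mem_nhds _ (by linarith)
  have hint := intervalIntegral.hasFDerivAt_integral_of_dominated_of_fderiv_le (𝕜 := ℂ)
    (μ := MeasureTheory.volume) (a := 0) (b := 2 * Real.pi)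
    (F := fun x θ => (deriv (circleMap 0 r) θ * (1 / (circleMap 0 r θ) ^ 2)) •
        f (x + circleMap 0 r θ • v))
    (F' := fun x θ => (deriv (circleMap 0 r) θ * (1 / (circleMap 0 r θ) ^ 2)) •
        fderiv ℂ f (x + circleMap 0 r θ • v))
    (bound := fun θ => ‖deriv (circleMap 0 r) θ * (1 / (circleMap 0 r θ) ^ 2)‖ * (2 / (δ / 2)))
    hδ4
    (Filter.eventually_of_mem hδ4 fun x hx => (hcont x hx).aestronglyMeasurable)
    ((hcont z₀ (mem_ball_self (by linarith))).intervalIntegrable _ _)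
    (hcoef.aestronglyMeasurable.smul
      ((measurable_fderiv ℂ f).comp
        (g := fderiv ℂ f) (f := fun θ : ℝ => z₀ + circleMap 0 r θ • v)
        (Continuous.measurable (by fun_prop))).aestronglyMeasurable)
    (Filter.Eventually.of_forall fun θ _ x hx => by
      rw [norm_smul]
      gcongr
      exact hbound _ (hmem x hx _ (hcircle θ)))
    ((hcoef.norm.mul continuous_const).intervalIntegrable _ _)
    (Filter.Eventually.of_forall fun θ _ x hx => by
      have h := (hd _ (hhalf (hmem x hx _ (hcircle θ)))).hasFDerivAt
      exact ((hasFDerivAt_comp_add_right (circleMap 0 r θ • v)).2 h).const_smul _)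
  refine DifferentiableAt.differentiableWithinAt ?_
  exact (hint.differentiableAt.const_smul (2 * Real.pi * Complex.I : ℂ)⁻¹).congr_of_eventuallyEq
    (Filter.eventually_of_mem hδ4 hcauchy)

/-- A holomorphic function of several variables is smooth. -/
theorem DifferentiableOn.contDiffOn_of_finiteDimensional
    [FiniteDimensional ℂ E] [FiniteDimensional ℂ F]
    {U : Set E} {f : E → F} (hf : DifferentiableOn ℂ f U) (hU : IsOpen U) (m : ℕ) :
    ContDiffOn ℂ m f U := by
  induction m generalizing f with
  | zero => exact contDiffOn_zero.2 hf.continuousOn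
  | succ m ih =>
    rw [Nat.cast_succ]
    refine contDiffOn_succ_of_fderiv_apply hf (fun h => by simp at h) fun v => ?_
    refine (ih (differentiableOn_fderiv_apply hf hU v)).congr fun x hx => ?_
    rw [fderivWithin_of_isOpen hU hx]

/-- The derivatives of the restriction of a smooth function to a line are the diagonal values of
the iterated Fréchet derivatives. -/
theorem iteratedDeriv_comp_add_smul {U : Set E} (hU : IsOpen U) {f : E → F}
    (hf : ∀ m : ℕ, ContDiffOn ℂ m f U) (a v : E) (m : ℕ) {t : ℂ} (ht : a + t • v ∈ U) :
    iteratedDeriv m (fun t : ℂ => f (a + t • v)) t =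
      iteratedFDeriv ℂ m f (a + t • v) fun _ => v := by
  induction m generalizing t with
  | zero => simp
  | succ m ih =>
    have hline : HasDerivAt (fun t : ℂ => a + t • v) v t := by
      simpa using ((hasDerivAt_id t).smul_const v).const_add a
    have hev : iteratedDeriv m (fun t : ℂ => f (a + t • v)) =ᶠ[nhds t]
        fun t => iteratedFDeriv ℂ m f (a + t • v) fun _ => v :=
      Filter.eventually_of_mem (hline.continuousAt.preimage_mem_nhds (hU.mem_nhds ht))
        fun s hs => ih hs
    have hdiff : DifferentiableAt ℂ (iteratedFDeriv ℂ m f) (a + t • v) :=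
      ((hf (m + 1)).contDiffAt (hU.mem_nhds ht)).differentiableAt_iteratedFDeriv
        (by exact_mod_cast Nat.lt_succ_self m)
    have hcomp := hdiff.hasFDerivAt.comp_hasDerivAt t hline
    rw [iteratedDeriv_succ, hev.deriv_eq, iteratedFDeriv_succ_apply_left]
    exact ((ContinuousMultilinearMap.apply ℂ (fun _ : Fin m => E) F
      fun _ => v).hasFDerivAt.comp_hasDerivAt t hcomp).deriv

/-- Holomorphic functions with the same derivatives at the center of a ball agree on the ball. -/
theorem DifferentiableOn.eqOn_ball_of_iteratedFDeriv_eq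
    [FiniteDimensional ℂ E] [FiniteDimensional ℂ F] {f g : E → F} {a : E} {r : ℝ}
    (hf : DifferentiableOn ℂ f (ball a r)) (hg : DifferentiableOn ℂ g (ball a r))
    (h : ∀ m : ℕ, iteratedFDeriv ℂ m f a = iteratedFDeriv ℂ m g a) :
    EqOn f g (ball a r) := by
  intro z hz
  have : CompleteSpace F := FiniteDimensional.complete ℂ F
  have hr : 0 < r := pos_of_mem_ball hz
  rcases eq_or_ne z a with rfl | hza
  · simpa using congrArg (fun p => p fun _ => 0) (h 0)
  have hv : 0 < ‖z - a‖ := norm_pos_iff.2 (sub_ne_zero.2 hza)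
  have hmem : ∀ t ∈ ball (0 : ℂ) (r / ‖z - a‖), a + t • (z - a) ∈ ball a r := by
    intro t ht
    rw [mem_ball_zero_iff, lt_div_iff₀ hv] at ht
    simpa [norm_smul] using ht
  have hline : ∀ {k : E → F}, DifferentiableOn ℂ k (ball a r) →
      DifferentiableOn ℂ (fun t : ℂ => k (a + t • (z - a))) (ball 0 (r / ‖z - a‖)) :=
    fun hk => hk.comp (f := fun t : ℂ => a + t • (z - a))
      (by fun_prop) hmem
  have h1 : (1 : ℂ) ∈ ball (0 : ℂ) (r / ‖z - a‖) := by
    rw [mem_ball_zero_iff, lt_div_iff₀ hv]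
    simpa [dist_eq_norm] using hz
  have hderiv : ∀ m : ℕ, iteratedDeriv m (fun t : ℂ => f (a + t • (z - a))) 0 =
      iteratedDeriv m (fun t : ℂ => g (a + t • (z - a))) 0 := by
    intro m
    have h0 : a + (0 : ℂ) • (z - a) ∈ ball a r := by simpa using hr
    rw [iteratedDeriv_comp_add_smul isOpen_ball
        (hf.contDiffOn_of_finiteDimensional isOpen_ball) a (z - a) m h0,
      iteratedDeriv_comp_add_smul isOpen_ball
        (hg.contDiffOn_of_finiteDimensional isOpen_ball) a (z - a) m h0]
    simp [h m]
  have hsf := Complex.hasSum_taylorSeries_on_ball (hline hf) h1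
  have hsg := Complex.hasSum_taylorSeries_on_ball (hline hg) h1
  simp only [hderiv] at hsf
  simpa using hsf.unique hsg

/-- Identity theorem: holomorphic functions of several variables on a preconnected open set
whose derivatives agree at one point coincide. -/
theorem DifferentiableOn.eqOn_of_isPreconnected_of_iteratedFDeriv_eq
    [FiniteDimensional ℂ E] [FiniteDimensional ℂ F] {U : Set E} {f g : E → F} {a : E}
    (hf : DifferentiableOn ℂ f U) (hg : DifferentiableOn ℂ g U) (hU : IsOpen U)
    (hconn : IsPreconnected U) (ha : a ∈ U)
    (h : ∀ m : ℕ, iteratedFDeriv ℂ m f a = iteratedFDeriv ℂ m g a) :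
    EqOn f g U := by
  have hball : ∀ {x : E} {r : ℝ}, ball x r ⊆ U →
      (∀ m : ℕ, iteratedFDeriv ℂ m f x = iteratedFDeriv ℂ m g x) → EqOn f g (ball x r) :=
    fun hsub hx => (hf.mono hsub).eqOn_ball_of_iteratedFDeriv_eq (hg.mono hsub) hx
  have hsub : U ⊆ {x | f =ᶠ[nhds x] g} := by
    refine hconn.subset_of_closure_inter_subset isOpen_setOfPred_eventually_nhds ?_ ?_
    · obtain ⟨r, hr, hrU⟩ := Metric.isOpen_iff.1 hU a ha
      exact ⟨a, ha, Filter.eventually_of_mem (ball_mem_nhds a hr) (hball hrU h)⟩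
    · rintro x ⟨hx, hxU⟩
      obtain ⟨r, hr, hrU⟩ := Metric.isOpen_iff.1 hU x hxU
      obtain ⟨y, hy, hxy⟩ := Metric.mem_closure_iff.1 hx (r / 2) (half_pos hr)
      have hyU : ball y (r / 2) ⊆ U :=
        (ball_subset_ball' (by rw [dist_comm]; linarith)).trans hrU
      exact Filter.eventually_of_mem (isOpen_ball.mem_nhds hxy)
        (hball hyU fun m => (Filter.EventuallyEq.iteratedFDeriv ℂ hy m).eq_of_nhds)
  exact fun x hx => (hsub hx).eq_of_nhds

end SeveralComplexVariables

/-- Uniqueness theorem: two `ℂⁿ`-holomorphic functions on a connected open set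
whose derivatives of all orders agree at one point coincide on the set. -/
theorem cnHolo_eqOn_of_iteratedFDeriv_eq {n : ℕ} {l : Fin n → ℕ}
    (U : Set (∀ j, Fin (l j) → ℂ)) (hU : IsOpen U) (hconn : IsConnected U)
    (f g : (∀ j, Fin (l j) → ℂ) → (Fin n → ℂ))
    (hf : CnHolo U f) (hg : CnHolo U g) (a : ∀ j, Fin (l j) → ℂ) (ha : a ∈ U)
    (hder : ∀ m : ℕ, iteratedFDeriv ℂ m f a = iteratedFDeriv ℂ m g a) :
    Set.EqOn f g U := by
  exact hf.1.eqOn_of_isPreconnected_of_iteratedFDeriv_eq hg.1 hU hconn.isPreconnected ha hder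
end

section
/- Let U ⊆ C^{l1}×...×C^{ln} be open, {K_m}_{m≥0} a sequence of compact subsets of U, and {p_m}_{m≥1} a sequence in U. Suppose U equals the union of the interiors of the K_m, K_m ⊆ K_{m+1} for all m, and p_{m+1} ∈ K_{m+1} ∖ K̂_m for all m ≥ 0 (where K̂_m is the C^n-holomorphically convex hull of K_m in U). Then there exists f ∈ O_{l1,...,ln}(U) such that |f(p_m)| ≥ m for all m ≥ 1. -/
open Set Metric

/-- The `ℂⁿ`-holomorphically convex hull of `K` in `U` (sup-norms throughout). -/
def cnHull {n : ℕ} {l : Fin n → ℕ} (U K : Set (∀ j, Fin (l j) → ℂ)) :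
    Set (∀ j, Fin (l j) → ℂ) :=
  {z ∈ U | ∀ f, CnHolo U f → ‖f z‖ ≤ sSup ((fun w => ‖f w‖) '' K)}

/-- A locally normally convergent series of holomorphic maps may be differentiated termwise. -/
theorem hasFDerivAt_tsum_of_norm_le_on_ball {E F : Type*} [NormedAddCommGroup E]
    [NormedSpace ℂ E] [NormedAddCommGroup F] [NormedSpace ℂ F] [CompleteSpace F]
    {g : ℕ → E → F} {u : ℕ → ℝ} {a : E} {r : ℝ} (hr : 0 < r)
    (hg : ∀ j, DifferentiableOn ℂ (g j) (ball a r)) (hu : Summable u)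
    (hgu : ∀ j, ∀ z ∈ ball a r, ‖g j z‖ ≤ u j) :
    Summable (fun j => fderiv ℂ (g j) a) ∧
      HasFDerivAt (fun z => ∑' j, g j z) (∑' j, fderiv ℂ (g j) a) a := by
  have hsub : ∀ x ∈ ball a (r / 2), ball x (r / 2) ⊆ ball a r := fun x hx =>
    ball_subset_ball' (by linarith [mem_ball.1 hx])
  have hbound : ∀ j, ∀ x ∈ ball a (r / 2), ‖fderiv ℂ (g j) x‖ ≤ 2 * u j / (r / 2) := by
    intro j x hx
    refine Complex.norm_fderiv_le_div_of_mapsTo_ball ((hg j).mono (hsub x hx)) ?_ (half_pos hr)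
    intro z hz
    have h₁ := hgu j z (hsub x hx hz)
    have h₂ := hgu j x (hsub x hx (mem_ball_self (half_pos hr)))
    rw [mem_closedBall, dist_eq_norm]
    linarith [norm_sub_le (g j z) (g j x)]
  have hu' : Summable fun j => 2 * u j / (r / 2) := (hu.mul_left 2).div_const _
  have ha : a ∈ ball a (r / 2) := mem_ball_self (half_pos hr)
  refine ⟨.of_norm_bounded hu' fun j => hbound j a ha, ?_⟩
  refine hasFDerivAt_tsum_of_isPreconnected hu' isOpen_ball
    (convex_ball a (r / 2)).isPreconnected (fun j x hx => ?_) hbound ha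
    (.of_norm_bounded hu fun j => hgu j a (mem_ball_self hr)) ha
  exact ((hg j).differentiableAt
    (isOpen_ball.mem_nhds (ball_subset_ball (half_le_self hr.le) hx))).hasFDerivAt

namespace CnHolo

variable {n : ℕ} {l : Fin n → ℕ} {U : Set (∀ j, Fin (l j) → ℂ)}

theorem fderiv_single_apply {f : (∀ j, Fin (l j) → ℂ) → (Fin n → ℂ)} (hU : IsOpen U)
    (hf : CnHolo U f) {a : ∀ j, Fin (l j) → ℂ} (ha : a ∈ U) {i j : Fin n} (hij : i ≠ j)
    (v : Fin (l j) → ℂ) : fderiv ℂ f a (Pi.single j v) i = 0 := by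
  have h := (hf.1.differentiableAt (hU.mem_nhds ha)).hasFDerivAt
  rw [← hf.2 a ha i j hij v, (hasFDerivAt_pi'.1 h i).fderiv]
  rfl

theorem div_const_pow {f : (∀ j, Fin (l j) → ℂ) → (Fin n → ℂ)} (hU : IsOpen U)
    (hf : CnHolo U f) (c : ℂ) (k : ℕ) : CnHolo U fun z i => (f z i / c) ^ k := by
  have hd : ∀ i, ∀ a ∈ U, DifferentiableAt ℂ (fun z => f z i) a := fun i a ha =>
    differentiableAt_pi.1 (hf.1.differentiableAt (hU.mem_nhds ha)) i
  have hd' : ∀ i, ∀ a ∈ U, HasFDerivAt (fun z => (f z i / c) ^ k)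
      ((k * (f a i / c) ^ (k - 1)) • c⁻¹ • fderiv ℂ (fun z => f z i) a) a := fun i a ha => by
    simpa [div_eq_mul_inv] using ((hd i a ha).hasFDerivAt.mul_const c⁻¹).pow k
  refine ⟨fun a ha => (differentiableAt_pi.2 fun i =>
    (hd' i a ha).differentiableAt).differentiableWithinAt, fun a ha i j hij v => ?_⟩
  rw [(hd' i a ha).fderiv]
  simp [hf.2 a ha i j hij v]

theorem tsum {g : ℕ → (∀ j, Fin (l j) → ℂ) → (Fin n → ℂ)} (hU : IsOpen U)
    (hg : ∀ k, CnHolo U (g k))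
    (hgu : ∀ a ∈ U, ∃ r > 0, ball a r ⊆ U ∧
      ∃ u : ℕ → ℝ, Summable u ∧ ∀ k, ∀ z ∈ ball a r, ‖g k z‖ ≤ u k) :
    CnHolo U fun z => ∑' k, g k z := by
  have key : ∀ a ∈ U, Summable (fun k => fderiv ℂ (g k) a) ∧
      HasFDerivAt (fun z => ∑' k, g k z) (∑' k, fderiv ℂ (g k) a) a := by
    intro a ha
    obtain ⟨r, hr, hrU, u, hu, hle⟩ := hgu a ha
    exact hasFDerivAt_tsum_of_norm_le_on_ball hr (fun k => (hg k).1.mono hrU) hu hle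
  refine ⟨fun a ha => (key a ha).2.differentiableAt.differentiableWithinAt,
    fun a ha i j hij v => ?_⟩
  rw [(hasFDerivAt_pi'.1 (key a ha).2 i).fderiv]
  have h := ((key a ha).1.hasSum.mapL (ContinuousLinearMap.apply ℂ (Fin n → ℂ) (Pi.single j v)))
  have h' := Pi.hasSum.1 h i
  simp only [ContinuousLinearMap.apply_apply, fderiv_single_apply hU (hg _) ha hij v] at h'
  exact h'.unique hasSum_zero

theorem exists_small_on_large_at {K : Set (∀ j, Fin (l j) → ℂ)} {q : ∀ j, Fin (l j) → ℂ}
    (hU : IsOpen U) (hK : IsCompact K) (hKU : K ⊆ U) (hq : q ∈ U) (hqK : q ∉ cnHull U K)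
    {ε : ℝ} (hε : 0 < ε) (R : ℝ) :
    ∃ g, CnHolo U g ∧ (∀ z ∈ K, ‖g z‖ ≤ ε) ∧ R ≤ ‖g q‖ := by
  obtain ⟨f, hf, hlt⟩ : ∃ f, CnHolo U f ∧ sSup ((fun w => ‖f w‖) '' K) < ‖f q‖ := by
    by_contra! h
    exact hqK ⟨hq, h⟩
  set s := sSup ((fun w => ‖f w‖) '' K)
  have hs0 : 0 ≤ s := Real.sSup_nonneg (by rintro _ ⟨w, -, rfl⟩; exact norm_nonneg _)
  have hbdd : BddAbove ((fun w => ‖f w‖) '' K) :=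
    hK.bddAbove_image (hf.1.continuousOn.mono hKU).norm
  obtain ⟨i, hi⟩ : ∃ i, s < ‖f q i‖ := by
    by_contra! h
    exact hlt.not_ge ((pi_norm_le_iff_of_nonneg hs0).2 h)
  obtain ⟨c, hsc, hct⟩ := exists_between hi
  have hc : 0 < c := hs0.trans_lt hsc
  have h₁ := tendsto_pow_atTop_nhds_zero_of_lt_one (div_nonneg hs0 hc.le) ((div_lt_one hc).2 hsc)
  have h₂ := tendsto_pow_atTop_atTop_of_one_lt ((one_lt_div hc).2 hct)
  obtain ⟨k, hk₁, hk₂⟩ :=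
    ((h₁.eventually_le_const hε).and (h₂.eventually_ge_atTop R)).exists
  have hnorm : ∀ z i, ‖(f z i / (c : ℂ)) ^ k‖ = (‖f z i‖ / c) ^ k := fun z i => by
    simp [abs_of_pos hc]
  refine ⟨_, hf.div_const_pow hU c k, fun z hz => (pi_norm_le_iff_of_nonneg hε.le).2 fun i => ?_,
    hk₂.trans ?_⟩
  · rw [hnorm]
    refine le_trans ?_ hk₁
    gcongr
    exact (norm_le_pi_norm (f z) i).trans (le_csSup hbdd ⟨z, hz, rfl⟩)
  · rw [← hnorm]
    exact norm_le_pi_norm (fun i => (f q i / (c : ℂ)) ^ k) i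

end CnHolo

/-- Given an exhaustion `K m` of `U` by compacts and points
`p (m+1) ∈ K (m+1)` outside the hull of `K m`, there is a `ℂⁿ`-holomorphic
function on `U` with `|f (p m)| ≥ m` for all `m ≥ 1`. -/
theorem cnHolo_unbounded_on_sequence {n : ℕ} {l : Fin n → ℕ}
    (U : Set (∀ j, Fin (l j) → ℂ)) (hU : IsOpen U)
    (K : ℕ → Set (∀ j, Fin (l j) → ℂ)) (p : ℕ → ∀ j, Fin (l j) → ℂ)
    (hKc : ∀ m, IsCompact (K m)) (hKU : ∀ m, K m ⊆ U)
    (hp : ∀ m, p m ∈ U)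
    (hcover : U = ⋃ m, interior (K m)) (hmono : ∀ m, K m ⊆ K (m + 1))
    (hpm : ∀ m, p (m + 1) ∈ K (m + 1) \ cnHull U (K m)) :
    ∃ f, CnHolo U f ∧ ∀ m : ℕ, 1 ≤ m → (m : ℝ) ≤ ‖f (p m)‖ := by
  have hgeom := summable_geometric_two
  choose G hG hGK hGp using fun m R => CnHolo.exists_small_on_large_at hU (hKc m) (hKU m)
    (hp (m + 1)) (hpm m).2 (ε := (1 / 2) ^ m) (by positivity) R
  let S : ℕ → (∀ j, Fin (l j) → ℂ) → (Fin n → ℂ) := fun m =>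
    Nat.rec 0 (fun m s z => s z + G m (m + 3 + ‖s (p (m + 1))‖) z) m
  let g : ℕ → (∀ j, Fin (l j) → ℂ) → (Fin n → ℂ) := fun m =>
    G m (m + 3 + ‖S m (p (m + 1))‖)
  have hS : ∀ m z, ∑ k ∈ Finset.range m, g k z = S m z := by
    intro m z
    induction m with
    | zero => rfl
    | succ m ih => rw [Finset.sum_range_succ, ih]
  have hK : ∀ m k z, z ∈ K m → ‖g (k + m) z‖ ≤ (1 / 2) ^ k := fun m k z hz =>
    (hGK _ _ z (monotone_nat_of_le_succ hmono (Nat.le_add_left m k) hz)).trans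
      (pow_le_pow_of_le_one (by norm_num) (by norm_num) (Nat.le_add_right k m))
  refine ⟨fun z => ∑' k, g k z, CnHolo.tsum hU (fun k => hG _ _) fun a ha => ?_, ?_⟩
  · rw [hcover, mem_iUnion] at ha
    obtain ⟨m, hm⟩ := ha
    obtain ⟨r, hr, hrm⟩ := Metric.isOpen_iff.1 isOpen_interior a hm
    have hrK : ball a r ⊆ K m := hrm.trans interior_subset
    choose C hC using fun k => (hKc m).exists_bound_of_continuousOn
      ((hG k (k + 3 + ‖S k (p (k + 1))‖)).1.continuousOn.mono (hKU m))
    refine ⟨r, hr, hrK.trans (hKU m), fun k => if k < m then C k else (1 / 2) ^ (k - m), ?_, ?_⟩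
    · rw [← summable_nat_add_iff m]
      simpa using hgeom
    · intro k z hz
      dsimp only
      split_ifs with hkm
      · exact hC k z (hrK hz)
      · simpa [Nat.sub_add_cancel (not_lt.1 hkm)] using hK m (k - m) z (hrK hz)
  · intro m hm
    obtain ⟨m, rfl⟩ := Nat.exists_eq_add_of_le' hm
    have htail := fun k => hK (m + 1) k (p (m + 1)) (hpm m).1
    have hsum : Summable fun k => g k (p (m + 1)) :=
      (summable_nat_add_iff (m + 1)).1 (.of_norm_bounded hgeom htail)
    have hT := tsum_of_norm_bounded hasSum_geometric_two htail
    have hg : (m : ℝ) + 3 + ‖S m (p (m + 1))‖ ≤ ‖g m (p (m + 1))‖ := hGp _ _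
    beta_reduce
    rw [← hsum.sum_add_tsum_nat_add (m + 1), Finset.sum_range_succ, hS]
    set A := S m (p (m + 1))
    set B := g m (p (m + 1))
    set T := ∑' k, g (k + (m + 1)) (p (m + 1))
    have h : ‖B‖ ≤ ‖A + B + T‖ + ‖A‖ + ‖T‖ := by
      calc ‖B‖ = ‖A + B + T - A - T‖ := by congr 1; abel
        _ ≤ ‖A + B + T - A‖ + ‖T‖ := norm_sub_le _ _
        _ ≤ _ := by gcongr; exact norm_sub_le _ _
    push_cast
    linarith
end

section
/- (C^n Cartan–Thullen theorem.) For an open set U ⊆ C^{l1}×...×C^{ln}, the following are equivalent: (a) U is a domain of C^n-existence; (b) U is a domain of C^n-holomorphy; (c) U is C^n-holomorphically convex. -/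
open Set Metric

/-- `U` is a domain of `ℂⁿ`-existence. -/
def IsDomainOfCnExistence {n : ℕ} {l : Fin n → ℕ}
    (U : Set (∀ j, Fin (l j) → ℂ)) : Prop :=
  ∃ f, CnHolo U f ∧ ∀ V W : Set (∀ j, Fin (l j) → ℂ), IsOpen V → IsOpen W →
    IsConnected V → (V \ U).Nonempty → W.Nonempty → W ⊆ U ∩ V →
    ∀ g, CnHolo V g → ¬ Set.EqOn f g W

/-- `U` is a domain of `ℂⁿ`-holomorphy. -/
def IsDomainOfCnHolomorphy {n : ℕ} {l : Fin n → ℕ}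
    (U : Set (∀ j, Fin (l j) → ℂ)) : Prop :=
  ∀ V W : Set (∀ j, Fin (l j) → ℂ), IsOpen V → IsOpen W →
    IsConnected V → (V \ U).Nonempty → W.Nonempty → W ⊆ U ∩ V →
    ∃ f, CnHolo U f ∧ ∀ g, CnHolo V g → ¬ Set.EqOn f g W

/-- `U` is `ℂⁿ`-holomorphically convex. -/
def IsCnHoloConvex {n : ℕ} {l : Fin n → ℕ}
    (U : Set (∀ j, Fin (l j) → ℂ)) : Prop :=
  ∀ K ⊆ U, IsCompact K → IsCompact (cnHull U K)

open Filter Topology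

section Banach

variable {E F : Type*} [NormedAddCommGroup E] [NormedSpace ℂ E]
  [NormedAddCommGroup F] [NormedSpace ℂ F]

/-- Cauchy's estimate for the Fréchet derivative. -/
theorem norm_fderiv_le_of_norm_le_ball {f : E → F} {c : E} {R M : ℝ} (hR : 0 < R)
    (hf : DifferentiableOn ℂ f (ball c R)) (hM : ∀ x ∈ ball c R, ‖f x‖ ≤ M) :
    ‖fderiv ℂ f c‖ ≤ 2 * M / R := by
  refine Complex.norm_fderiv_le_div_of_mapsTo_ball hf (fun x hx => ?_) hR
  rw [mem_closedBall, dist_eq_norm]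
  linarith [norm_sub_le (f x) (f c), hM x hx, hM c (mem_ball_self hR)]

theorem norm_taylor_remainder_le {f : E → F} {c y : E} {R M : ℝ}
    (hf : DifferentiableOn ℂ f (ball c R)) (hM : ∀ x ∈ ball c R, ‖f x‖ ≤ M)
    (hy : y ∈ ball c R) :
    ‖f y - f c - fderiv ℂ f c (y - c)‖ ≤ 4 * M * (‖y - c‖ / R) ^ 2 := by
  have hR : 0 < R := pos_of_mem_ball hy
  have hd : HasFDerivAt f (fderiv ℂ f c) c :=
    (hf.differentiableAt (ball_mem_nhds c hR)).hasFDerivAt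
  have key := Complex.dist_le_mul_div_pow_of_mapsTo_ball_of_isLittleO (n := 1)
    (f := fun y => f y - f c - fderiv ℂ f c (y - c)) (c := c) (z := y) (R₁ := R) (R₂ := 4 * M)
    (by fun_prop) ?_ ?_ hy
  · simpa [dist_eq_norm] using key
  · intro x hx
    have h1 := norm_fderiv_le_of_norm_le_ball hR hf hM
    have h2 : ‖fderiv ℂ f c (x - c)‖ ≤ 2 * M / R * R :=
      ((fderiv ℂ f c).le_opNorm _).trans (by
        have : ‖x - c‖ ≤ R := (mem_ball_iff_norm.1 hx).le
        gcongr
        exact (norm_nonneg _).trans h1)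
    rw [div_mul_cancel₀ _ hR.ne'] at h2
    simp only [mem_closedBall, dist_eq_norm, sub_self, map_zero, sub_zero]
    linarith [norm_sub_le (f x - f c) (fderiv ℂ f c (x - c)), norm_sub_le (f x) (f c), hM x hx,
      hM c (mem_ball_self hR)]
  · simpa using hd.isLittleO.norm_right

theorem differentiableAt_and_tendsto_fderiv_of_summable_bound [CompleteSpace F]
    {f : ℕ → E → F} {g : E → F} {u : ℕ → ℝ} {c x : E} {R : ℝ}
    (hf : ∀ k, DifferentiableOn ℂ (f k) (ball c R)) (hu : Summable u)
    (hb : ∀ k, ∀ y ∈ ball c R, ‖f (k + 1) y - f k y‖ ≤ u k)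
    (hg : ∀ y ∈ ball c R, Tendsto (fun k => f k y) atTop (𝓝 (g y))) (hx : x ∈ ball c R) :
    DifferentiableAt ℂ g x ∧
      Tendsto (fun k => fderiv ℂ (f k) x) atTop (𝓝 (fderiv ℂ g x)) := by
  obtain ⟨r, hr, hsub⟩ := Metric.isOpen_iff.1 isOpen_ball x hx
  have hr2 : 0 < r / 2 := half_pos hr
  have hsub' : ∀ y ∈ ball x (r / 2), ball y (r / 2) ⊆ ball c R := fun y hy =>
    (ball_subset_ball' (by rw [mem_ball] at hy; linarith)).trans hsub
  have hmem : ∀ y ∈ ball x (r / 2), y ∈ ball c R := fun y hy =>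
    hsub' y hy (mem_ball_self hr2)
  have hdiff : ∀ k, ∀ y ∈ ball c R, DifferentiableAt ℂ (f k) y := fun k y hy =>
    (hf k).differentiableAt (isOpen_ball.mem_nhds hy)
  have hd : ∀ k, DifferentiableOn ℂ (fun y => f (k + 1) y - f k y) (ball c R) := fun k =>
    (hf (k + 1)).sub (hf k)
  have hsum : ∀ y ∈ ball c R, HasSum (fun k => f (k + 1) y - f k y) (g y - f 0 y) := by
    intro y hy
    have hs : Summable (fun k => f (k + 1) y - f k y) :=
      .of_norm_bounded hu fun k => hb k y hy
    refine (hs.hasSum_iff_tendsto_nat).2 ?_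
    simpa [Finset.sum_range_sub (fun k => f k y)] using (hg y hy).sub_const (f 0 y)
  have hx2 : x ∈ ball x (r / 2) := mem_ball_self hr2
  have hbd : ∀ k, ∀ y ∈ ball x (r / 2),
      ‖fderiv ℂ (fun y => f (k + 1) y - f k y) y‖ ≤ 2 * u k / (r / 2) := fun k y hy =>
    norm_fderiv_le_of_norm_le_ball hr2 ((hd k).mono (hsub' y hy))
      fun z hz => hb k z (hsub' y hy hz)
  have hu' : Summable fun k => 2 * u k / (r / 2) := (hu.mul_left 2).div_const _
  have key := hasFDerivAt_tsum_of_isPreconnected hu' isOpen_ball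
    (convex_ball x (r / 2)).isPreconnected
    (fun k y hy => ((hd k).differentiableAt
      (isOpen_ball.mem_nhds (hmem y hy))).hasFDerivAt) hbd hx2 (hsum x hx).summable hx2
  have hgx : HasFDerivAt g
      ((∑' k, fderiv ℂ (fun y => f (k + 1) y - f k y) x) + fderiv ℂ (f 0) x) x := by
    refine (key.add (hdiff 0 x hx).hasFDerivAt).congr_of_eventuallyEq ?_
    filter_upwards [isOpen_ball.mem_nhds hx] with y hy
    simp [(hsum y hy).tsum_eq]
  refine ⟨hgx.differentiableAt, ?_⟩
  have hs : Summable fun k => fderiv ℂ (fun y => f (k + 1) y - f k y) x :=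
    .of_norm_bounded hu' fun k => hbd k x hx2
  have ht := hs.hasSum.tendsto_sum_nat.add_const (fderiv ℂ (f 0) x)
  rw [hgx.fderiv]
  refine ht.congr fun k => ?_
  have : ∀ i, fderiv ℂ (fun y => f (i + 1) y - f i y) x
      = fderiv ℂ (f (i + 1)) x - fderiv ℂ (f i) x := fun i =>
    fderiv_fun_sub (hdiff _ x hx) (hdiff _ x hx)
  simp [this, Finset.sum_range_sub (fun k => fderiv ℂ (f k) x)]

theorem DifferentiableOn.fderiv_apply_const [CompleteSpace F] {f : E → F} {U : Set E}
    (hU : IsOpen U) (hf : DifferentiableOn ℂ f U) (v : E) :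
    DifferentiableOn ℂ (fun x => fderiv ℂ f x v) U := by
  intro a ha
  refine DifferentiableAt.differentiableWithinAt ?_
  obtain ⟨R, hR, M, hRU, hM⟩ : ∃ R > 0, ∃ M, ball a (2 * R) ⊆ U ∧
      ∀ x ∈ ball a (2 * R), ‖f x‖ ≤ M := by
    have hc : ContinuousAt f a := hf.continuousOn.continuousAt (hU.mem_nhds ha)
    have h1 : ∀ᶠ x in 𝓝 a, x ∈ U ∧ ‖f x‖ < ‖f a‖ + 1 :=
      (hU.eventually_mem ha).and (hc.norm.eventually_lt_const (by linarith))
    obtain ⟨ε, hε, h⟩ := Metric.eventually_nhds_iff_ball.1 h1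
    refine ⟨ε / 2, half_pos hε, ‖f a‖ + 1, ?_, ?_⟩ <;> rw [mul_div_cancel₀ _ two_ne_zero]
    · exact fun x hx => (h x hx).1
    · exact fun x hx => (h x hx).2.le
  suffices H : ∀ v : E, ‖v‖ < R → DifferentiableAt ℂ (fun x => fderiv ℂ f x v) a by
    obtain ⟨t, ht0, ht⟩ : ∃ t : ℂ, t ≠ 0 ∧ ‖t • v‖ < R := by
      have : Tendsto (fun t : ℂ => ‖t • v‖) (𝓝[≠] 0) (𝓝 0) := by
        have h : Continuous fun t : ℂ => ‖t • v‖ := by fun_prop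
        simpa using (h.tendsto 0).mono_left nhdsWithin_le_nhds
      obtain ⟨t, h1, h2⟩ := ((this.eventually_lt_const hR).and self_mem_nhdsWithin).exists
      exact ⟨t, h2, h1⟩
    have h := (H _ ht).const_smul t⁻¹
    refine h.congr_of_eventuallyEq (.of_forall fun x => ?_)
    simp [inv_smul_smul₀ ht0]
  intro v hv
  have hM0 : 0 ≤ M := (norm_nonneg _).trans (hM a (mem_ball_self (by positivity)))
  have hsub : ∀ x ∈ ball a R, ball x R ⊆ ball a (2 * R) := fun x hx =>
    ball_subset_ball' (by rw [mem_ball] at hx; linarith)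
  have hnorm : ∀ k : ℕ, ‖((1 / 2 : ℂ) ^ k) • v‖ = (1 / 2) ^ k * ‖v‖ := fun k => by
    simp [norm_smul]
  have hlt : ∀ k : ℕ, ‖((1 / 2 : ℂ) ^ k) • v‖ < R := fun k => by
    rw [hnorm]
    exact (mul_le_of_le_one_left (norm_nonneg v)
      (pow_le_one₀ (by norm_num) (by norm_num))).trans_lt hv
  set q : ℕ → E → F := fun k x => (2 : ℂ) ^ k • (f (x + (1 / 2 : ℂ) ^ k • v) - f x) with hq
  have hest : ∀ k, ∀ x ∈ ball a R,
      ‖q k x - fderiv ℂ f x v‖ ≤ 4 * M * (‖v‖ / R) ^ 2 * (1 / 2) ^ k := by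
    intro k x hx
    have h := norm_taylor_remainder_le (y := x + (1 / 2 : ℂ) ^ k • v)
      (hf.mono ((hsub x hx).trans hRU)) (fun y hy => hM y (hsub x hx hy))
      (by simpa [mem_ball_iff_norm] using hlt k)
    have h2 : q k x - fderiv ℂ f x v = (2 : ℂ) ^ k • (f (x + (1 / 2 : ℂ) ^ k • v) - f x -
        fderiv ℂ f x (x + (1 / 2 : ℂ) ^ k • v - x)) := by
      rw [add_sub_cancel_left, map_smul, smul_sub, smul_smul, ← mul_pow]
      norm_num [hq]
    rw [h2, norm_smul, norm_pow, Complex.norm_ofNat]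
    rw [add_sub_cancel_left, hnorm] at h
    rw [add_sub_cancel_left]
    refine (mul_le_mul_of_nonneg_left h (by positivity)).trans_eq ?_
    have : (2 : ℝ) ^ k * (1 / 2) ^ k = 1 := by rw [← mul_pow]; norm_num
    calc _ = 4 * M * (‖v‖ / R) ^ 2 * (1 / 2) ^ k * ((2 : ℝ) ^ k * (1 / 2) ^ k) := by ring
      _ = _ := by rw [this, mul_one]
  have hgeo : Summable fun k : ℕ => ((1 : ℝ) / 2) ^ k := summable_geometric_two
  refine (differentiableAt_and_tendsto_fderiv_of_summable_bound (f := q) (c := a) (R := R)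
    (u := fun k => 2 * (4 * M * (‖v‖ / R) ^ 2) * (1 / 2) ^ k)
    (fun k => ?_) (hgeo.mul_left _) (fun k x hx => ?_) (fun x hx => ?_) (mem_ball_self hR)).1
  · refine DifferentiableOn.const_smul (DifferentiableOn.sub ?_ (hf.mono fun x hx =>
      hRU (hsub x hx (mem_ball_self hR)))) _
    refine hf.comp (by fun_prop) fun x hx => hRU (hsub x hx ?_)
    simpa [mem_ball_iff_norm] using hlt k
  · have h1 := hest (k + 1) x hx
    have h2 := hest k x hx
    have h3 := norm_sub_le (q (k + 1) x - fderiv ℂ f x v) (q k x - fderiv ℂ f x v)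
    rw [sub_sub_sub_cancel_right] at h3
    have h4 : 4 * M * (‖v‖ / R) ^ 2 * (1 / 2) ^ (k + 1) ≤ 4 * M * (‖v‖ / R) ^ 2 * (1 / 2) ^ k :=
      mul_le_mul_of_nonneg_left (pow_le_pow_of_le_one (by norm_num) (by norm_num) k.le_succ)
        (by positivity)
    linarith
  · rw [tendsto_iff_norm_sub_tendsto_zero]
    refine squeeze_zero (fun _ => norm_nonneg _) (fun k => hest k x hx) ?_
    simpa using (tendsto_pow_atTop_nhds_zero_of_lt_one (r := (1 / 2 : ℝ))
      (by norm_num) (by norm_num)).const_mul (4 * M * (‖v‖ / R) ^ 2)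

theorem DifferentiableOn.fderiv_of_finiteDimensional [FiniteDimensional ℂ E] [CompleteSpace F]
    {f : E → F} {U : Set E} (hU : IsOpen U) (hf : DifferentiableOn ℂ f U) :
    DifferentiableOn ℂ (fderiv ℂ f) U := by
  let d := Module.finrank ℂ E
  have hd : d = Module.finrank ℂ (Fin d → ℂ) := (Module.finrank_fin_fun ℂ).symm
  let e₁ := ContinuousLinearEquiv.ofFinrankEq hd
  let e₂ := (e₁.arrowCongr (1 : F ≃L[ℂ] F)).trans (ContinuousLinearEquiv.piRing (Fin d))
  rw [← Function.id_comp (fderiv ℂ f), ← e₂.symm_comp_self]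
  exact e₂.symm.differentiable.comp_differentiableOn
    (differentiableOn_pi.2 fun i => hf.fderiv_apply_const hU _)

theorem differentiableOn_iteratedFDeriv [FiniteDimensional ℂ E] [CompleteSpace F]
    {f : E → F} {U : Set E} (hU : IsOpen U) (hf : DifferentiableOn ℂ f U) (k : ℕ) :
    DifferentiableOn ℂ (iteratedFDeriv ℂ k f) U := by
  induction k with
  | zero =>
    rw [iteratedFDeriv_zero_eq_comp]
    exact (continuousMultilinearCurryFin0 ℂ E F).symm.differentiable.comp_differentiableOn hf
  | succ k ih =>
    rw [iteratedFDeriv_succ_eq_comp_left]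
    have h := DifferentiableOn.fderiv_of_finiteDimensional hU ih
    let e : (E →L[ℂ] ContinuousMultilinearMap ℂ (fun _ : Fin k => E) F) →L[ℂ]
        ContinuousMultilinearMap ℂ (fun _ : Fin (k + 1) => E) F :=
      (continuousMultilinearCurryLeftEquiv ℂ (fun _ : Fin (k + 1) => E) F).symm
    exact e.differentiable.comp_differentiableOn h

theorem norm_iteratedFDeriv_le_of_norm_le [FiniteDimensional ℂ E] [CompleteSpace F]
    {f : E → F} {U : Set E} {M δ : ℝ} (hU : IsOpen U) (hf : DifferentiableOn ℂ f U)
    (hM : ∀ x ∈ U, ‖f x‖ ≤ M) (hδ : 0 < δ) (k : ℕ) (x : E) (hx : x ∈ U)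
    (hxk : ball x (k * δ) ⊆ U) : ‖iteratedFDeriv ℂ k f x‖ ≤ (2 / δ) ^ k * M := by
  induction k generalizing x with
  | zero => simpa using hM x hx
  | succ k ih =>
    have hsub : ball x δ ⊆ U := (ball_subset_ball (by
      push_cast; nlinarith [k.cast_nonneg (α := ℝ)])).trans hxk
    rw [← norm_fderiv_iteratedFDeriv]
    refine (norm_fderiv_le_of_norm_le_ball (M := (2 / δ) ^ k * M) hδ
      ((differentiableOn_iteratedFDeriv hU hf k).mono hsub)
      fun y hy => ih y (hsub hy) ((ball_subset_ball' ?_).trans hxk)).trans_eq ?_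
    · rw [mem_ball] at hy
      push_cast
      linarith
    · ring

theorem norm_iteratedFDeriv_le_factorial_mul [FiniteDimensional ℂ E] [CompleteSpace F]
    {f : E → F} {c : E} {M R : ℝ} (hR : 0 < R) (hf : DifferentiableOn ℂ f (ball c R))
    (hM : ∀ x ∈ ball c R, ‖f x‖ ≤ M) (k : ℕ) :
    ‖iteratedFDeriv ℂ k f c‖ ≤
      k.factorial * (Real.exp 1 * M) * (2 * Real.exp 1 / R) ^ k := by
  have hM0 : 0 ≤ M := (norm_nonneg _).trans (hM c (mem_ball_self hR))
  have hk : (0 : ℝ) < k + 1 := by positivity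
  refine (norm_iteratedFDeriv_le_of_norm_le isOpen_ball hf hM (div_pos hR hk) k c
    (mem_ball_self hR) (ball_subset_ball ?_)).trans ?_
  · rw [← mul_div_assoc, div_le_iff₀ hk]
    nlinarith
  · have h1 := Real.pow_div_factorial_le_exp (k + 1 : ℝ) hk.le k
    rw [div_le_iff₀ (by positivity), Real.exp_add, ← Real.exp_one_pow] at h1
    have h2 : (2 / (R / (k + 1 : ℝ))) ^ k = (2 / R) ^ k * (k + 1 : ℝ) ^ k := by
      rw [← mul_pow]; congr 1; field_simp
    rw [h2]
    calc _ ≤ (2 / R) ^ k * (Real.exp 1 ^ k * Real.exp 1 * k.factorial) * M := by gcongr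
      _ = _ := by rw [mul_div_right_comm, mul_pow]; ring

/-- Taylor expansion of a holomorphic function along a ray. -/
theorem hasSum_iteratedFDeriv_of_differentiableOn_ball [FiniteDimensional ℂ E] [CompleteSpace F]
    {f : E → F} {z y : E} {r : ℝ} (hf : DifferentiableOn ℂ f (ball z r)) (hy : ‖y‖ < r) :
    HasSum (fun k : ℕ => (k.factorial : ℂ)⁻¹ • iteratedFDeriv ℂ k f z fun _ => y) (f (z + y)) := by
  have hr : 0 < r := (norm_nonneg y).trans_lt hy
  obtain ⟨s, hs1, hs⟩ : ∃ s : ℝ, 1 < s ∧ s * ‖y‖ < r := by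
    have hp : 0 < ‖y‖ + r := by positivity
    refine ⟨2 * r / (‖y‖ + r), (one_lt_div hp).2 (by linarith), ?_⟩
    rw [div_mul_eq_mul_div, div_lt_iff₀ hp]
    nlinarith
  have hmaps : ∀ t ∈ ball (0 : ℂ) s, z + t • y ∈ ball z r := fun t ht => by
    rw [mem_ball_iff_norm, add_sub_cancel_left, norm_smul]
    rw [mem_ball_zero_iff] at ht
    exact (mul_le_mul_of_nonneg_right ht.le (norm_nonneg y)).trans_lt hs
  have hder : ∀ k : ℕ, ∀ t ∈ ball (0 : ℂ) s, iteratedDeriv k (fun t : ℂ => f (z + t • y)) t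
      = iteratedFDeriv ℂ k f (z + t • y) fun _ => y := by
    intro k
    induction k with
    | zero => intro t _; simp
    | succ k ih =>
      intro t ht
      have hev : iteratedDeriv k (fun t : ℂ => f (z + t • y)) =ᶠ[𝓝 t]
          fun t => iteratedFDeriv ℂ k f (z + t • y) fun _ => y :=
        eventually_of_mem (isOpen_ball.mem_nhds ht) ih
      rw [iteratedDeriv_succ, hev.deriv_eq, iteratedFDeriv_succ_apply_left]
      have h1 : HasFDerivAt (iteratedFDeriv ℂ k f) (fderiv ℂ (iteratedFDeriv ℂ k f) (z + t • y))
          (z + t • y) := ((differentiableOn_iteratedFDeriv isOpen_ball hf k).differentiableAt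
            (isOpen_ball.mem_nhds (hmaps t ht))).hasFDerivAt
      have h2 : HasDerivAt (fun t : ℂ => z + t • y) y t := by
        simpa using ((hasDerivAt_id t).smul_const y).const_add z
      have h3 := (ContinuousMultilinearMap.apply ℂ (fun _ : Fin k => E) F
        fun _ => y).hasFDerivAt.comp_hasDerivAt t (h1.comp_hasDerivAt t h2)
      exact h3.deriv
  have hφ : DifferentiableOn ℂ (fun t : ℂ => f (z + t • y)) (ball 0 s) :=
    hf.comp (by fun_prop) hmaps
  have h := Complex.hasSum_taylorSeries_on_ball hφ (z := 1) (by simpa using hs1)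
  simp only [sub_zero, one_pow, one_smul] at h
  convert h using 3 with k
  simpa using (hder k 0 (mem_ball_self (zero_lt_one.trans hs1))).symm

theorem exists_analyticOnNhd_ball_of_iteratedFDeriv_le [FiniteDimensional ℂ E] [CompleteSpace F]
    {f : E → F} {U : Set E} {z : E} {M ρ : ℝ} (hU : IsOpen U) (hf : DifferentiableOn ℂ f U)
    (hz : z ∈ U) (hρ : 0 < ρ)
    (hb : ∀ k, ‖iteratedFDeriv ℂ k f z‖ ≤ k.factorial * M * (1 / ρ) ^ k) :
    ∃ g, AnalyticOnNhd ℂ g (ball z ρ) ∧ f =ᶠ[𝓝 z] g := by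
  let p : FormalMultilinearSeries ℂ E F := fun k =>
    ((k.factorial : ℂ)⁻¹) • iteratedFDeriv ℂ k f z
  have hrad : ENNReal.ofReal ρ ≤ p.radius := by
    refine p.le_radius_of_bound M (r := ρ.toNNReal) fun k => ?_
    rw [Real.coe_toNNReal _ hρ.le, norm_smul, norm_inv, Complex.norm_natCast]
    have hk : (0 : ℝ) < k.factorial := by positivity
    calc _ ≤ (k.factorial : ℝ)⁻¹ * (k.factorial * M * (1 / ρ) ^ k) * ρ ^ k := by
          gcongr; exact hb k
      _ = M := by rw [one_div, inv_pow]; field_simp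
  have hpos : 0 < p.radius := (ENNReal.ofReal_pos.2 hρ).trans_le hrad
  have hp := (p.hasFPowerSeriesOnBall hpos)
  have hp' : HasFPowerSeriesOnBall (fun x => p.sum (x - z)) p z p.radius := by
    simpa using hp.comp_sub z
  refine ⟨fun x => p.sum (x - z), fun x hx => hp'.analyticAt_of_mem ?_, ?_⟩
  · refine Metric.eball_subset_eball hrad ?_
    rwa [Metric.eball_ofReal]
  obtain ⟨r, hr, hrU⟩ := Metric.isOpen_iff.1 hU z hz
  filter_upwards [ball_mem_nhds z hr] with x hx
  have hy : ‖x - z‖ < r := mem_ball_iff_norm.1 hx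
  have h := hasSum_iteratedFDeriv_of_differentiableOn_ball (hf.mono hrU) hy
  rw [add_sub_cancel] at h
  simpa [FormalMultilinearSeries.sum, p] using h.tsum_eq.symm

end Banach

theorem DifferentiableOn.analyticOnNhd_of_finiteDimensional {E F : Type*} [NormedAddCommGroup E]
    [NormedSpace ℂ E] [NormedAddCommGroup F] [NormedSpace ℂ F] [FiniteDimensional ℂ E]
    [CompleteSpace F] {f : E → F} {U : Set E} (hU : IsOpen U) (hf : DifferentiableOn ℂ f U) :
    AnalyticOnNhd ℂ f U := by
  intro a ha
  have hc : ContinuousAt f a := hf.continuousOn.continuousAt (hU.mem_nhds ha)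
  have h1 : ∀ᶠ x in 𝓝 a, x ∈ U ∧ ‖f x‖ < ‖f a‖ + 1 :=
    (hU.eventually_mem ha).and (hc.norm.eventually_lt_const (by linarith))
  obtain ⟨R, hR, h⟩ := Metric.eventually_nhds_iff_ball.1 h1
  have hρ : 0 < R / (2 * Real.exp 1) := by positivity
  obtain ⟨g, hg, hfg⟩ := exists_analyticOnNhd_ball_of_iteratedFDeriv_le hU hf ha hρ fun k => by
    rw [one_div_div]
    exact norm_iteratedFDeriv_le_factorial_mul hR (hf.mono fun x hx => (h x hx).1)
      (fun x hx => (h x hx).2.le) k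
  exact (hg a (mem_ball_self hρ)).congr hfg.symm

section CnHolo

variable {n : ℕ} {l : Fin n → ℕ} {U : Set (∀ j, Fin (l j) → ℂ)}
  {f g : (∀ j, Fin (l j) → ℂ) → (Fin n → ℂ)}

theorem cnHolo_iff (hU : IsOpen U) :
    CnHolo U f ↔ DifferentiableOn ℂ f U ∧ ∀ a ∈ U, ∀ i j : Fin n, i ≠ j →
      ∀ v : Fin (l j) → ℂ, fderiv ℂ f a (Pi.single j v) i = 0 := by
  refine and_congr_right fun hf => forall₂_congr fun a ha => ?_
  have h := hf.differentiableAt (hU.mem_nhds ha)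
  simp only [fderiv_apply h]
  rfl

theorem cnHolo_const (c : Fin n → ℂ) : CnHolo U fun _ => c :=
  ⟨differentiableOn_const c, fun a _ i j _ v => by simp⟩

theorem CnHolo.add (hU : IsOpen U) (hf : CnHolo U f) (hg : CnHolo U g) :
    CnHolo U fun x => f x + g x := by
  rw [cnHolo_iff hU] at *
  refine ⟨hf.1.add hg.1, fun a ha i j hij v => ?_⟩
  rw [fderiv_fun_add (hf.1.differentiableAt (hU.mem_nhds ha))
    (hg.1.differentiableAt (hU.mem_nhds ha))]
  simp [hf.2 a ha i j hij v, hg.2 a ha i j hij v]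

theorem CnHolo.mul (hU : IsOpen U) (hf : CnHolo U f) (hg : CnHolo U g) :
    CnHolo U fun x => f x * g x := by
  refine ⟨hf.1.mul hg.1, fun a ha i j hij v => ?_⟩
  have hfi : DifferentiableAt ℂ (fun x => f x i) a :=
    differentiableAt_pi.1 (hf.1.differentiableAt (hU.mem_nhds ha)) i
  have hgi : DifferentiableAt ℂ (fun x => g x i) a :=
    differentiableAt_pi.1 (hg.1.differentiableAt (hU.mem_nhds ha)) i
  simp only [Pi.mul_apply]
  rw [fderiv_fun_mul hfi hgi]
  simp [hf.2 a ha i j hij v, hg.2 a ha i j hij v]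

theorem CnHolo.pow (hU : IsOpen U) (hf : CnHolo U f) (p : ℕ) : CnHolo U fun x => f x ^ p := by
  induction p with
  | zero => simpa using cnHolo_const 1
  | succ p ih => simpa only [pow_succ] using ih.mul hU hf

theorem cnHolo_single_coord (j : Fin n) (k : Fin (l j)) :
    CnHolo U fun x => Pi.single j (x j k) := by
  have hd : Differentiable ℂ fun x : ∀ j, Fin (l j) → ℂ => x j k := by fun_prop
  refine ⟨(differentiable_pi.2 fun i => ?_).differentiableOn, fun a _ i m him v => ?_⟩
  · rcases eq_or_ne i j with rfl | h
    · simpa using hd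
    · simp [Pi.single_eq_of_ne h]
  · rcases eq_or_ne i j with rfl | h
    · simp only [Pi.single_eq_same]
      let L : (∀ j, Fin (l j) → ℂ) →L[ℂ] ℂ :=
        (ContinuousLinearMap.proj (R := ℂ) (φ := fun _ : Fin (l i) => ℂ) k).comp
          (ContinuousLinearMap.proj (R := ℂ) (φ := fun j => Fin (l j) → ℂ) i)
      have : HasFDerivAt (fun x : ∀ j, Fin (l j) → ℂ => x i k) L a := L.hasFDerivAt
      rw [this.fderiv]
      change (Pi.single m v : ∀ j, Fin (l j) → ℂ) i k = 0
      simp [Pi.single_eq_of_ne him]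
    · simp [Pi.single_eq_of_ne h]

theorem CnHolo.congr (hU : IsOpen U) (hf : CnHolo U f) (h : EqOn g f U) : CnHolo U g := by
  rw [cnHolo_iff hU] at *
  refine ⟨hf.1.congr h, fun a ha i j hij v => ?_⟩
  rw [(h.eventuallyEq_of_mem (hU.mem_nhds ha)).fderiv_eq]
  exact hf.2 a ha i j hij v

theorem CnHolo.analyticOnNhd (hU : IsOpen U) (hf : CnHolo U f) : AnalyticOnNhd ℂ f U :=
  hf.1.analyticOnNhd_of_finiteDimensional hU

theorem CnHolo.fderiv_apply_const (hU : IsOpen U) (hf : CnHolo U f) (v : ∀ j, Fin (l j) → ℂ) :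
    CnHolo U fun x => fderiv ℂ f x v := by
  have hd := hf.1.fderiv_of_finiteDimensional hU
  rw [cnHolo_iff hU]
  refine ⟨hf.1.fderiv_apply_const hU v, fun a ha i j hij w => ?_⟩
  have hda := hd.differentiableAt (hU.mem_nhds ha)
  have hsymm : IsSymmSndFDerivAt ℂ f a :=
    (hf.analyticOnNhd hU a ha).contDiffAt.isSymmSndFDerivAt (by simp) (n := ⊤)
  have happly : ∀ u w, fderiv ℂ (fun x => fderiv ℂ f x u) a w = fderiv ℂ (fderiv ℂ f) a w u :=
    fun u w => by rw [fderiv_clm_apply hda (differentiableAt_const u)]; simp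
  rw [happly, hsymm.eq, ← happly]
  have h0 : (fun x => fderiv ℂ f x (Pi.single j w) i) =ᶠ[𝓝 a] fun _ => 0 :=
    eventually_of_mem (hU.mem_nhds ha) fun x hx => ((cnHolo_iff hU).1 hf).2 x hx i j hij w
  have h1 := h0.fderiv_eq (𝕜 := ℂ)
  rw [fderiv_apply (hda.clm_apply (differentiableAt_const _))] at h1
  simpa using congrArg (fun L => L v) h1

theorem CnHolo.iteratedFDeriv_apply_const (hU : IsOpen U) (hf : CnHolo U f) (k : ℕ)
    (m : Fin k → ∀ j, Fin (l j) → ℂ) : CnHolo U fun x => iteratedFDeriv ℂ k f x m := by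
  induction k with
  | zero => simpa using hf
  | succ k ih =>
    refine ((ih (Fin.tail m)).fderiv_apply_const hU (m 0)).congr hU fun x hx => ?_
    exact ((differentiableOn_iteratedFDeriv hU hf.1 k).differentiableAt
      (hU.mem_nhds hx)).iteratedFDeriv_succ_apply_left'

theorem CnHolo.of_eventuallyEq {V : Set (∀ j, Fin (l j) → ℂ)} {z : ∀ j, Fin (l j) → ℂ}
    (hU : IsOpen U) (hf : CnHolo U f) (hzU : z ∈ U) (hVc : IsPreconnected V)
    (hzV : z ∈ V) (hg : AnalyticOnNhd ℂ g V) (hfg : f =ᶠ[𝓝 z] g) : CnHolo V g := by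
  refine ⟨hg.differentiableOn, fun a ha i j hij v => ?_⟩
  have hgi : AnalyticOnNhd ℂ (fun x => g x i) V := fun x hx =>
    (ContinuousLinearMap.proj (R := ℂ) (φ := fun _ : Fin n => ℂ) i).analyticAt _ |>.comp (hg x hx)
  have h1 : AnalyticOnNhd ℂ (fun x => fderiv ℂ (fun x => g x i) x (Pi.single j v)) V :=
    fun x hx => ((ContinuousLinearMap.apply ℂ ℂ
      (Pi.single j v : ∀ j, Fin (l j) → ℂ)).analyticAt _).comp (hgi.fderiv x hx)
  refine h1.eqOn_of_preconnected_of_eventuallyEq (g := fun _ => 0) (fun _ _ => analyticAt_const)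
    hVc hzV ?_ ha
  filter_upwards [hfg.eventuallyEq_nhds, hU.mem_nhds hzU] with x hx hxU
  have h2 : (fun x => g x i) =ᶠ[𝓝 x] fun x => f x i := hx.mono fun y hy => (congrFun hy i).symm
  rw [h2.fderiv_eq]
  exact hf.2 x hxU i j hij v

theorem norm_le_of_mem_cnHull {K : Set (∀ j, Fin (l j) → ℂ)} {z : ∀ j, Fin (l j) → ℂ} {B : ℝ}
    (hz : z ∈ cnHull U K) (hf : CnHolo U f) (hB : 0 ≤ B) (h : ∀ w ∈ K, ‖f w‖ ≤ B) : ‖f z‖ ≤ B :=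
  (hz.2 f hf).trans (Real.sSup_le (forall_mem_image.2 h) hB)

theorem isCompact_cnHull_of_ball_subset {K : Set (∀ j, Fin (l j) → ℂ)} {ρ : ℝ}
    (hU : IsOpen U) (hK : IsCompact K) (hρ : 0 < ρ) (h : ∀ z ∈ cnHull U K, ball z ρ ⊆ U) :
    IsCompact (cnHull U K) := by
  refine Metric.isCompact_of_isClosed_isBounded (isClosed_of_closure_subset fun x hx => ?_) ?_
  · obtain ⟨z, hz, hxz⟩ := Metric.mem_closure_iff.1 hx ρ hρ
    have hxU : x ∈ U := h z hz hxz
    refine ⟨hxU, fun f hf => le_of_not_gt fun hlt => ?_⟩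
    have hc : ContinuousAt f x := hf.1.continuousOn.continuousAt (hU.mem_nhds hxU)
    obtain ⟨y, hy, hy'⟩ := ((mem_closure_iff_frequently.1 hx).and_eventually
      (hc.norm.eventually_const_lt hlt)).exists
    exact hy'.not_ge (hy.2 f hf)
  · obtain ⟨B, hB0, hB⟩ := hK.isBounded.exists_pos_norm_le
    refine isBounded_iff_forall_norm_le.2 ⟨B, fun z hz => ?_⟩
    refine (pi_norm_le_iff_of_nonneg hB0.le).2 fun j => (pi_norm_le_iff_of_nonneg hB0.le).2
      fun k => ?_
    have := norm_le_of_mem_cnHull hz (cnHolo_single_coord j k) hB0.le fun w hw => ?_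
    · simpa [Pi.norm_single] using this
    · rw [Pi.norm_single]
      exact ((norm_le_pi_norm _ k).trans (norm_le_pi_norm w j)).trans (hB w hw)

theorem IsDomainOfCnHolomorphy.isCnHoloConvex (hU : IsOpen U) (h : IsDomainOfCnHolomorphy U) :
    IsCnHoloConvex U := by
  intro K hKU hK
  obtain ⟨R, hR, hRU⟩ := hK.exists_cthickening_subset_open hU hKU
  have hρ : 0 < R / (2 * Real.exp 1) := by positivity
  set ρ := R / (2 * Real.exp 1) with hρ_def
  refine isCompact_cnHull_of_ball_subset hU hK hρ fun z hz => ?_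
  by_contra hne
  obtain ⟨ε, hε, hεU⟩ := Metric.isOpen_iff.1 (hU.inter isOpen_ball) z
    ⟨hz.1, mem_ball_self (ε := ρ) hρ⟩
  have hconn : IsConnected (ball z ρ) :=
    ⟨nonempty_ball.2 hρ, (convex_ball z ρ).isPreconnected⟩
  obtain ⟨f, hf, hfext⟩ := h (ball z ρ) (ball z ε) isOpen_ball isOpen_ball hconn
    (not_subset.1 hne) (nonempty_ball.2 hε) hεU
  obtain ⟨M, hM0, hM⟩ : ∃ M, 0 ≤ M ∧ ∀ x ∈ cthickening R K, ‖f x‖ ≤ M := by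
    obtain ⟨M, hM⟩ := hK.cthickening.exists_bound_of_continuousOn (hf.1.continuousOn.mono hRU)
    exact ⟨max M 0, le_max_right _ _, fun x hx => (hM x hx).trans (le_max_left _ _)⟩
  have hball : ∀ w ∈ K, ball w R ⊆ cthickening R K := fun w hw =>
    (ball_subset_thickening hw R).trans (thickening_subset_cthickening R K)
  have hbound : ∀ k, ‖iteratedFDeriv ℂ k f z‖ ≤
      k.factorial * (Real.exp 1 * M) * (1 / ρ) ^ k := by
    intro k
    rw [hρ_def, one_div_div]
    refine ContinuousMultilinearMap.opNorm_le_bound (by positivity) fun m => ?_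
    refine norm_le_of_mem_cnHull hz (hf.iteratedFDeriv_apply_const hU k m) (by positivity)
      fun w hw => (ContinuousMultilinearMap.le_opNorm _ m).trans ?_
    gcongr
    exact norm_iteratedFDeriv_le_factorial_mul hR (hf.1.mono ((hball w hw).trans hRU))
      (fun x hx => hM x (hball w hw hx)) k
  obtain ⟨g, hg, hfg⟩ :=
    exists_analyticOnNhd_ball_of_iteratedFDeriv_le hU hf.1 hz.1 hρ hbound
  refine hfext g (hf.of_eventuallyEq hU hz.1 hconn.isPreconnected
    (mem_ball_self hρ) hg hfg) ?_
  exact ((hf.analyticOnNhd hU).mono (hεU.trans inter_subset_left)).eqOn_of_preconnected_of_eventuallyEq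
    (hg.mono (hεU.trans inter_subset_right)) (convex_ball z ε).isPreconnected (mem_ball_self hε) hfg

end CnHolo

section Exhaustion

variable {E : Type*} [NormedAddCommGroup E] [ProperSpace E] {U : Set E}

theorem exists_compact_exhaustion_ball (hU : IsOpen U) (hne : Uᶜ.Nonempty) :
    ∃ K : ℕ → Set E, (∀ m, IsCompact (K m)) ∧ (∀ m, K m ⊆ U) ∧
      ∀ x ∈ U, ∃ r > 0, ∃ N, ∀ m ≥ N, ball x r ⊆ K m := by
  have hpos : ∀ x, x ∈ U ↔ 0 < infDist x Uᶜ := fun x => by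
    rw [← hU.isClosed_compl.notMem_iff_infDist_pos hne, notMem_compl_iff]
  refine ⟨fun m => closedBall 0 m ∩ {x | 1 / ((m : ℝ) + 1) ≤ infDist x Uᶜ}, fun m => ?_,
    fun m x hx => ?_, fun x hx => ?_⟩
  · exact (isCompact_closedBall _ _).inter_right
      (isClosed_le continuous_const (continuous_infDist_pt _))
  · exact (hpos x).2 (lt_of_lt_of_le (by positivity) hx.2)
  · set δ := infDist x Uᶜ with hδ
    have hδ0 : 0 < δ := (hpos x).1 hx
    obtain ⟨N₁, hN₁⟩ := exists_nat_ge (‖x‖ + δ / 2)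
    obtain ⟨N₂, hN₂⟩ := exists_nat_one_div_lt (half_pos hδ0)
    refine ⟨δ / 2, half_pos hδ0, max N₁ N₂, fun m hm y hy => ⟨?_, ?_⟩⟩
    · have h1 : ‖y‖ ≤ ‖x‖ + dist y x := by
        rw [dist_eq_norm]
        exact norm_le_norm_add_norm_sub' y x
      have h2 : (N₁ : ℝ) ≤ m := by exact_mod_cast (le_max_left _ _).trans hm
      rw [mem_closedBall_zero_iff]
      linarith [mem_ball.1 hy]
    · have h1 : δ ≤ infDist y Uᶜ + dist x y := infDist_le_infDist_add_dist
      have h2 : 1 / ((m : ℝ) + 1) ≤ 1 / ((N₂ : ℝ) + 1) :=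
        Nat.one_div_le_one_div ((le_max_right _ _).trans hm)
      rw [dist_comm] at h1
      change 1 / ((m : ℝ) + 1) ≤ infDist y Uᶜ
      linarith [mem_ball.1 hy]

theorem exists_mem_ball_infDist_compl_notMem [NormedSpace ℝ E] {H : Set E} {w : E}
    (hU : IsOpen U) (hne : Uᶜ.Nonempty) (hH : IsClosed H) (hHU : H ⊆ U) (hw : w ∈ U) :
    ∃ z ∈ ball w (infDist w Uᶜ), z ∉ H := by
  by_contra! h
  have hpos : 0 < infDist w Uᶜ :=
    (hU.isClosed_compl.notMem_iff_infDist_pos hne).1 (notMem_compl_iff.2 hw)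
  obtain ⟨q, hq, hqd⟩ := hU.isClosed_compl.exists_infDist_eq_dist hne w
  have h1 : closedBall w (infDist w Uᶜ) ⊆ H := by
    rw [← closure_ball w hpos.ne']
    exact closure_minimal h hH
  exact hq (hHU (h1 (by rw [mem_closedBall, dist_comm, hqd])))

end Exhaustion

section Existence

variable {n : ℕ} {l : Fin n → ℕ} {U : Set (∀ j, Fin (l j) → ℂ)}

theorem CnHolo.exists_large_of_notMem_cnHull {S : (∀ j, Fin (l j) → ℂ) → (Fin n → ℂ)}
    {K : Set (∀ j, Fin (l j) → ℂ)} {z : ∀ j, Fin (l j) → ℂ} (hU : IsOpen U) (hS : CnHolo U S)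
    (hK : IsCompact K) (hKU : K ⊆ U) (hzU : z ∈ U) (hz : z ∉ cnHull U K) {δ : ℝ} (hδ : 0 < δ)
    (N : ℝ) : ∃ S', CnHolo U S' ∧ (∀ x ∈ K, ‖S' x - S x‖ ≤ δ) ∧ N ≤ ‖S' z‖ := by
  obtain ⟨h, hh, hlt⟩ : ∃ h, CnHolo U h ∧ sSup ((fun w => ‖h w‖) '' K) < ‖h z‖ := by
    by_contra! hcon
    exact hz ⟨hzU, hcon⟩
  set σ := sSup ((fun w => ‖h w‖) '' K)
  have hσ0 : 0 ≤ σ := Real.sSup_nonneg (by rintro _ ⟨w, _, rfl⟩; exact norm_nonneg _)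
  have hσ : ∀ w ∈ K, ‖h w‖ ≤ σ := fun w hw =>
    le_csSup (hK.image_of_continuousOn (hh.1.continuousOn.mono hKU).norm).bddAbove
      (mem_image_of_mem _ hw)
  have hz0 : 0 < ‖h z‖ := hσ0.trans_lt hlt
  set A := |N| + ‖S z‖
  have hA : 0 ≤ A := by positivity
  obtain ⟨p, hp0, hp⟩ : ∃ p : ℕ, 0 < p ∧ A * (σ / ‖h z‖) ^ p < δ := by
    have ht : Tendsto (fun p : ℕ => A * (σ / ‖h z‖) ^ p) atTop (𝓝 (A * 0)) :=
      (tendsto_pow_atTop_nhds_zero_of_lt_one (by positivity)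
        ((div_lt_one hz0).2 hlt)).const_mul A
    rw [mul_zero] at ht
    exact ((eventually_gt_atTop 0).and (ht.eventually_lt_const hδ)).exists
  obtain ⟨i, hi⟩ : ∃ i, ‖h z‖ ≤ ‖h z i‖ := by
    by_contra! hcon
    exact lt_irrefl _ ((pi_norm_lt_iff hz0).2 hcon)
  set c : ℂ := ((A / ‖h z‖ ^ p : ℝ) : ℂ) with hc
  have hcn : ‖c‖ = A / ‖h z‖ ^ p := by
    rw [hc, Complex.norm_real, Real.norm_of_nonneg (by positivity)]
  refine ⟨fun x => S x + (fun _ => c) * h x ^ p, hS.add hU ((cnHolo_const _).mul hU (hh.pow hU p)),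
    fun x hx => ?_, ?_⟩
  · have hsmul : (fun _ => c) * h x ^ p = c • h x ^ p := rfl
    rw [add_sub_cancel_left, hsmul, norm_smul, hcn]
    calc A / ‖h z‖ ^ p * ‖h x ^ p‖ ≤ A / ‖h z‖ ^ p * σ ^ p := by
          gcongr
          exact (norm_pow_le' _ hp0).trans (pow_le_pow_left₀ (norm_nonneg _) (hσ x hx) p)
      _ = A * (σ / ‖h z‖) ^ p := by rw [div_pow]; ring
      _ ≤ δ := hp.le
  · have h1 : A ≤ ‖(fun _ => c) * h z ^ p‖ := by
      refine le_trans ?_ (norm_le_pi_norm ((fun _ => c) * h z ^ p) i)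
      rw [Pi.mul_apply, Pi.pow_apply, norm_mul, hcn, norm_pow]
      calc A = A / ‖h z‖ ^ p * ‖h z‖ ^ p := by field_simp
        _ ≤ _ := by gcongr
    have h2 : ∀ a b : Fin n → ℂ, ‖b‖ ≤ ‖a + b‖ + ‖a‖ := fun a b => by
      simpa using norm_sub_le (a + b) a
    change N ≤ ‖S z + (fun _ => c) * h z ^ p‖
    linarith [le_abs_self N, h2 (S z) ((fun _ => c) * h z ^ p)]

theorem exists_cnHolo_tendsto (hU : IsOpen U) {S : ℕ → (∀ j, Fin (l j) → ℂ) → (Fin n → ℂ)}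
    (hS : ∀ j, CnHolo U (S j)) {K : ℕ → Set (∀ j, Fin (l j) → ℂ)}
    (hK : ∀ x ∈ U, ∃ r > 0, ∃ N, ∀ m ≥ N, ball x r ⊆ K m) (hKU : ∀ m, K m ⊆ U)
    (h : ∀ j, ∀ x ∈ K j, ‖S (j + 1) x - S j x‖ ≤ (1 / 2) ^ j) :
    ∃ f, CnHolo U f ∧ ∀ x ∈ U, Tendsto (fun j => S j x) atTop (𝓝 (f x)) := by
  have hle : ∀ N j : ℕ, ((1 : ℝ) / 2) ^ (j + N) ≤ 1 * (1 / 2) ^ j := fun N j => by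
    rw [one_mul]
    exact pow_le_pow_of_le_one (by norm_num) (by norm_num) (Nat.le_add_right _ _)
  have hlim : ∀ x ∈ U, ∃ y, Tendsto (fun j => S j x) atTop (𝓝 y) := fun x hx => by
    obtain ⟨r, hr, N, hN⟩ := hK x hx
    refine cauchySeq_tendsto_of_complete ?_
    refine (cauchySeq_shift N).1 (cauchySeq_of_le_geometric (1 / 2) 1 (by norm_num) fun j => ?_)
    rw [dist_comm, dist_eq_norm, add_right_comm]
    exact (h _ _ (hN _ (Nat.le_add_left _ _) (mem_ball_self hr))).trans (hle N j)
  choose! f hf using hlim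
  have hder : ∀ x ∈ U, ∃ N, DifferentiableAt ℂ f x ∧
      Tendsto (fun j => fderiv ℂ (S (j + N)) x) atTop (𝓝 (fderiv ℂ f x)) := fun x hx => by
    obtain ⟨r, hr, N, hN⟩ := hK x hx
    have hrU : ball x r ⊆ U := (hN N le_rfl).trans (hKU N)
    refine ⟨N, differentiableAt_and_tendsto_fderiv_of_summable_bound
      (f := fun j => S (j + N)) (u := fun j => 1 * (1 / 2) ^ j) (R := r) (c := x)
      (fun j => (hS _).1.mono hrU) (summable_geometric_two.mul_left 1) (fun j y hy => ?_)
      (fun y hy => (tendsto_add_atTop_iff_nat N).2 (hf y (hrU hy))) (mem_ball_self hr)⟩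
    rw [add_right_comm]
    exact (h _ _ (hN _ (Nat.le_add_left _ _) hy)).trans (hle N j)
  refine ⟨f, (cnHolo_iff hU).2 ⟨fun x hx => ?_, fun x hx i j hij v => ?_⟩, hf⟩
  · obtain ⟨N, hd, -⟩ := hder x hx
    exact hd.differentiableWithinAt
  · obtain ⟨N, -, ht⟩ := hder x hx
    have h1 : Tendsto (fun k => fderiv ℂ (S (k + N)) x (Pi.single j v) i) atTop
        (𝓝 (fderiv ℂ f x (Pi.single j v) i)) :=
      tendsto_pi_nhds.1 (((ContinuousLinearMap.apply ℂ (Fin n → ℂ)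
        (Pi.single j v : ∀ j, Fin (l j) → ℂ)).continuous.tendsto _).comp ht) i
    simp only [((cnHolo_iff hU).1 (hS _)).2 x hx i j hij v] at h1
    exact tendsto_nhds_unique h1 tendsto_const_nhds

theorem IsCnHoloConvex.exists_cnHolo_large (hU : IsOpen U) (hconv : IsCnHoloConvex U)
    (hne : Uᶜ.Nonempty) {w : ℕ → ∀ j, Fin (l j) → ℂ} (hw : ∀ j, w j ∈ U) :
    ∃ f, CnHolo U f ∧ ∀ j, ∃ z ∈ ball (w j) (infDist (w j) Uᶜ), (j : ℝ) - 2 ≤ ‖f z‖ := by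
  obtain ⟨K, hKc, hKU, hK⟩ := exists_compact_exhaustion_ball hU hne
  let T := {p : Set (∀ j, Fin (l j) → ℂ) × ((∀ j, Fin (l j) → ℂ) → (Fin n → ℂ)) //
    IsCompact p.1 ∧ p.1 ⊆ U ∧ CnHolo U p.2}
  have hstep : ∀ (j : ℕ) (p : T), ∃ p' : T, p.1.1 ∪ K j ⊆ p'.1.1 ∧
      (∀ x ∈ p.1.1 ∪ K j, ‖p'.1.2 x - p.1.2 x‖ ≤ (1 / 2) ^ j) ∧
      ∃ z ∈ ball (w j) (infDist (w j) Uᶜ), z ∈ p'.1.1 ∧ (j : ℝ) ≤ ‖p'.1.2 z‖ := by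
    rintro j ⟨⟨L, S⟩, hL, hLU, hS⟩
    have hc : IsCompact (L ∪ K j) := hL.union (hKc j)
    have hsub : L ∪ K j ⊆ U := union_subset hLU (hKU j)
    obtain ⟨z, hzb, hz⟩ := exists_mem_ball_infDist_compl_notMem hU hne
      (hconv _ hsub hc).isClosed (fun x hx => hx.1) (hw j)
    have hzU : z ∈ U := ball_infDist_compl_subset hzb
    obtain ⟨S', hS', hdiff, hlarge⟩ := hS.exists_large_of_notMem_cnHull hU hc hsub hzU hz
      (δ := (1 / 2) ^ j) (by positivity) j
    exact ⟨⟨⟨insert z (L ∪ K j), S'⟩, hc.insert z, insert_subset hzU hsub, hS'⟩,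
      subset_insert _ _, hdiff, z, hzb, mem_insert _ _, hlarge⟩
  choose F hFsub hFdiff hFlarge using hstep
  obtain ⟨p, hp⟩ : ∃ p : ℕ → T, ∀ j, p (j + 1) = F j (p j) :=
    ⟨fun j => Nat.rec ⟨⟨∅, fun _ => 0⟩, isCompact_empty, empty_subset _, cnHolo_const 0⟩ F j,
      fun _ => rfl⟩
  replace hFsub : ∀ j, (p j).1.1 ∪ K j ⊆ (p (j + 1)).1.1 := fun j => hp j ▸ hFsub j (p j)
  replace hFdiff : ∀ j, ∀ x ∈ (p j).1.1 ∪ K j,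
      ‖(p (j + 1)).1.2 x - (p j).1.2 x‖ ≤ (1 / 2) ^ j := fun j => hp j ▸ hFdiff j (p j)
  replace hFlarge : ∀ j, ∃ z ∈ ball (w j) (infDist (w j) Uᶜ), z ∈ (p (j + 1)).1.1 ∧
      (j : ℝ) ≤ ‖(p (j + 1)).1.2 z‖ := fun j => hp j ▸ hFlarge j (p j)
  have hmono : Monotone fun j => (p j).1.1 :=
    monotone_nat_of_le_succ fun j => subset_union_left.trans (hFsub j)
  obtain ⟨f, hf, hlim⟩ := exists_cnHolo_tendsto hU (S := fun j => (p j).1.2)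
    (fun j => (p j).2.2.2) hK hKU fun j x hx => hFdiff j x (Or.inr hx)
  refine ⟨f, hf, fun j => ?_⟩
  obtain ⟨z, hzb, hzL, hz⟩ := hFlarge j
  refine ⟨z, hzb, ?_⟩
  have hd := dist_le_of_le_geometric_of_tendsto₀ (1 / 2) 1 (f := fun m => (p (m + (j + 1))).1.2 z)
    (by norm_num) (fun m => ?_)
    ((tendsto_add_atTop_iff_nat (j + 1)).2 (hlim z (ball_infDist_compl_subset hzb)))
  · have h1 : ‖(p (0 + (j + 1))).1.2 z‖ ≤ ‖f z‖ + dist ((p (0 + (j + 1))).1.2 z) (f z) := by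
      rw [dist_eq_norm]
      exact norm_le_norm_add_norm_sub' _ _
    rw [zero_add] at h1
    have h2 : (j : ℝ) ≤ ‖(p (j + 1)).1.2 z‖ := hz
    simp only [zero_add] at hd
    norm_num at hd
    linarith
  · rw [dist_comm, dist_eq_norm, add_right_comm, one_mul]
    refine (hFdiff (m + (j + 1)) z (Or.inl (hmono (Nat.le_add_left _ _) hzL))).trans ?_
    exact pow_le_pow_of_le_one (by norm_num) (by norm_num) (Nat.le_add_right _ _)

/-- A holomorphic function on `U` which agrees on part of `V` with one on `V` agrees with it on
a ball that is maximal in `U`, is centred in a given dense set, and has compact closure in `V`. -/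
theorem exists_ball_infDist_compl_eqOn {E F : Type*} [NormedAddCommGroup E] [NormedSpace ℂ E]
    [NormedAddCommGroup F] [NormedSpace ℂ F] [ProperSpace E] {f g : E → F} {U V W D : Set E}
    (hU : IsOpen U) (hV : IsOpen V) (hW : IsOpen W) (hVc : IsPreconnected V)
    (hVU : (V \ U).Nonempty) (hWne : W.Nonempty) (hWUV : W ⊆ U ∩ V) (hD : Dense D)
    (hf : AnalyticOnNhd ℂ f U) (hg : AnalyticOnNhd ℂ g V) (hfg : EqOn f g W) :
    ∃ w ∈ D ∩ U, EqOn f g (ball w (infDist w Uᶜ)) ∧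
      closure (ball w (infDist w Uᶜ)) ⊆ V := by
  let _ : NormedSpace ℝ E := NormedSpace.restrictScalars ℝ ℂ E
  obtain ⟨x₀, hx₀⟩ := hWne
  have hUV : IsOpen (U ∩ V) := hU.inter hV
  set C := connectedComponentIn (U ∩ V) x₀ with hC
  have hCo : IsOpen C := hUV.connectedComponentIn
  have hCUV : C ⊆ U ∩ V := connectedComponentIn_subset _ _
  have hx₀C : x₀ ∈ C := mem_connectedComponentIn (hWUV hx₀)
  have hCeq : EqOn f g C :=
    (hf.mono (hCUV.trans inter_subset_left)).eqOn_of_preconnected_of_eventuallyEq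
      (hg.mono (hCUV.trans inter_subset_right)) isPreconnected_connectedComponentIn hx₀C
      (hfg.eventuallyEq_of_mem (hW.mem_nhds hx₀))
  have hmax : ∀ (y r), y ∈ C → ∀ c, y ∈ ball c r → ball c r ⊆ U ∩ V → ball c r ⊆ C :=
    fun y r hy c hyb hsub => by
      rw [hC, connectedComponentIn_eq hy]
      exact (convex_ball c r).isPreconnected.subset_connectedComponentIn hyb hsub
  obtain ⟨q, hq, hqV, hqC⟩ : ∃ q ∈ closure C, q ∈ V ∧ q ∉ C := by
    by_contra! hcon
    have h1 : V ⊆ C := hVc.subset_of_closure_inter_subset hCo ⟨x₀, (hWUV hx₀).2, hx₀C⟩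
      fun q hq => hcon q hq.1 hq.2
    obtain ⟨y, hyV, hyU⟩ := hVU
    exact hyU (hCUV (h1 hyV)).1
  have hqU : q ∉ U := fun hqU => by
    obtain ⟨ε, hε, hsub⟩ := Metric.isOpen_iff.1 hUV q ⟨hqU, hqV⟩
    obtain ⟨y, hy, hyq⟩ := Metric.mem_closure_iff.1 hq ε hε
    exact hqC (hmax y ε hy q (by rwa [mem_ball, dist_comm]) hsub (mem_ball_self hε))
  obtain ⟨ε, hε, hsub⟩ := Metric.isOpen_iff.1 hV q hqV
  obtain ⟨w, hwD, hwC, hwq⟩ : ∃ w ∈ D, w ∈ C ∧ w ∈ ball q (ε / 3) :=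
    hD.exists_mem_open (hCo.inter isOpen_ball) <| by
      obtain ⟨y, hy, hyq⟩ := Metric.mem_closure_iff.1 hq (ε / 3) (by positivity)
      exact ⟨y, hy, by rwa [mem_ball, dist_comm]⟩
  have hwU : w ∈ U := (hCUV hwC).1
  have hr0 : 0 < infDist w Uᶜ :=
    (hU.isClosed_compl.notMem_iff_infDist_pos ⟨q, hqU⟩).1 (notMem_compl_iff.2 hwU)
  have hr : infDist w Uᶜ ≤ dist w q := infDist_le_dist_of_mem hqU
  have hclosure : closure (ball w (infDist w Uᶜ)) ⊆ V := fun x hx => by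
    refine hsub ?_
    have h1 := mem_closedBall.1 (closure_ball_subset_closedBall hx)
    have h2 := mem_ball.1 hwq
    have h3 := dist_triangle x w q
    rw [mem_ball]
    linarith
  refine ⟨w, ⟨hwD, hwU⟩, hCeq.mono ?_, hclosure⟩
  exact hmax w _ hwC w (mem_ball_self hr0)
    (subset_inter ball_infDist_compl_subset (subset_closure.trans hclosure))

theorem IsCnHoloConvex.isDomainOfCnExistence (hU : IsOpen U) (hconv : IsCnHoloConvex U) :
    IsDomainOfCnExistence U := by
  rcases U.eq_empty_or_nonempty with rfl | ⟨u, hu⟩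
  · refine ⟨0, cnHolo_const 0, fun V W _ _ _ _ hW hWU => ?_⟩
    obtain ⟨x, hx⟩ := hW
    exact absurd (hWU hx).1 (notMem_empty x)
  rcases (Uᶜ).eq_empty_or_nonempty with hcompl | hne
  · refine ⟨0, cnHolo_const 0, fun V W _ _ _ hV _ _ => ?_⟩
    obtain ⟨x, -, hx⟩ := hV
    exact absurd (mem_compl hx) (hcompl ▸ notMem_empty x)
  classical
  let d := TopologicalSpace.denseSeq (∀ j, Fin (l j) → ℂ)
  let w : ℕ → ∀ j, Fin (l j) → ℂ := fun j => if d j.unpair.1 ∈ U then d j.unpair.1 else u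
  have hw : ∀ j, w j ∈ U := fun j => by
    simp only [w]
    split_ifs with h
    exacts [h, hu]
  obtain ⟨f, hf, hlarge⟩ := hconv.exists_cnHolo_large hU hne hw
  refine ⟨f, hf, fun V W hV hW hVc hVU hWne hWUV g hg hfg => ?_⟩
  obtain ⟨_, ⟨⟨i, rfl⟩, hiU⟩, heq, hcl⟩ := exists_ball_infDist_compl_eqOn hU hV hW
    hVc.isPreconnected hVU hWne hWUV (TopologicalSpace.denseRange_denseSeq _)
    (hf.analyticOnNhd hU) (hg.analyticOnNhd hV) hfg
  obtain ⟨M, hM⟩ := (isBounded_ball.isCompact_closure).exists_bound_of_continuousOn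
    (hg.1.continuousOn.mono hcl)
  obtain ⟨k, hk⟩ := exists_nat_gt (M + 2)
  obtain ⟨z, hz, hfz⟩ := hlarge (Nat.pair i k)
  have hwi : w (Nat.pair i k) = d i := by
    simp only [w, Nat.unpair_pair]
    exact if_pos hiU
  rw [hwi] at hz
  have h1 : ‖f z‖ ≤ M := by
    rw [heq hz]
    exact hM z (subset_closure hz)
  have h2 : (k : ℝ) ≤ Nat.pair i k := by exact_mod_cast Nat.right_le_pair i k
  linarith

end Existence

/-- Cartan–Thullen theorem for `ℂⁿ`-holomorphic functions: for an open set `U`,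
being a domain of `ℂⁿ`-existence, a domain of `ℂⁿ`-holomorphy, and
`ℂⁿ`-holomorphic convexity are all equivalent. -/
theorem cnCartanThullen {n : ℕ} {l : Fin n → ℕ}
    (U : Set (∀ j, Fin (l j) → ℂ)) (hU : IsOpen U) :
    (IsDomainOfCnExistence U ↔ IsDomainOfCnHolomorphy U) ∧
      (IsDomainOfCnHolomorphy U ↔ IsCnHoloConvex U) := by
  have hab : IsDomainOfCnExistence U → IsDomainOfCnHolomorphy U :=
    fun ⟨f, hf, h⟩ V W hV hW hVc hVU hWne hWUV => ⟨f, hf, h V W hV hW hVc hVU hWne hWUV⟩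
  have hbc : IsDomainOfCnHolomorphy U → IsCnHoloConvex U := fun h => h.isCnHoloConvex hU
  have hca : IsCnHoloConvex U → IsDomainOfCnExistence U := fun h => h.isDomainOfCnExistence hU
  exact ⟨⟨hab, hca ∘ hbc⟩, ⟨hbc, hab ∘ hca⟩⟩
end
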